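/- arXiv:2003.09479 — 5 statements merged into one kernel-verified Lean document; each statement's English description precedes it below -/
import Mathlib

section
/- Let p_1,…,p_t be odd primes, n_1,…,n_t positive integers, and G = ∏_{i=1}^t (ℤ_{p_i} ≀ Sym_{n_i}) as described. Let H be a nontrivial subgroup of G of odd index such that for every i ∈ {1,…,t} the image of π_i(H) in B_i = Sym_{n_i} acts preprimitively on {1,…,n_i}. Then for every subgroup K of G with H ≤ K, the subgroup H is pronormal in K if and only if π_i(H) is pronormal in π_i(K) for every i ∈ {1,…,t}. -/
/-- A subgroup `H` of a group `G` is *pronormal* in `G` if for every `g : G` the subgroups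
`H` and `H^g` are conjugate by an element of the subgroup `⟨H, H^g⟩` they generate. -/
def IsPronormal {G : Type*} [Group G] (H : Subgroup G) : Prop :=
  ∀ g : G, ∃ x ∈ H ⊔ H.map (MulAut.conj g).toMonoidHom,
    H.map (MulAut.conj x).toMonoidHom = H.map (MulAut.conj g).toMonoidHom

/-- The action of `Sym n` on `n`-tuples over `A` by permutation of coordinates. -/
def permAction (n : ℕ) (A : Type*) [AddCommGroup A] :
    Equiv.Perm (Fin n) →* MulAut (Multiplicative (Fin n → A)) where
  toFun σ := AddEquiv.toMultiplicative
    { Equiv.arrowCongr σ (Equiv.refl A) with map_add' := fun _ _ => rfl }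
  map_one' := by ext v; rfl
  map_mul' := fun σ τ => by ext v; rfl

/-- The wreath product `ℤ_p ≀ Sym_n` realized as the semidirect product `V ⋊ B`,
where `V = (Fin n → ZMod p)` and `B = Equiv.Perm (Fin n)` permutes coordinates. -/
abbrev Wreath (p n : ℕ) : Type :=
  Multiplicative (Fin n → ZMod p) ⋊[permAction n (ZMod p)] Equiv.Perm (Fin n)

/-- The additive subgroup of constant tuples. -/
def constTuples (p n : ℕ) : AddSubgroup (Fin n → ZMod p) where
  carrier := {v | ∀ i j, v i = v j}
  add_mem' := fun ha hb i j => by simp only [Pi.add_apply, ha i j, hb i j]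
  zero_mem' := fun i j => rfl
  neg_mem' := fun ha i j => by simp only [Pi.neg_apply, ha i j]

/-- The additive subgroup of tuples whose coordinates sum to `0`. -/
def sumZero (p n : ℕ) : AddSubgroup (Fin n → ZMod p) where
  carrier := {v | ∑ i, v i = 0}
  add_mem' := fun {a b} ha hb => by
    simp only [Set.mem_setOf_eq, Pi.add_apply, Finset.sum_add_distrib] at *
    rw [ha, hb, add_zero]
  zero_mem' := by simp
  neg_mem' := fun {a} ha => by
    simp only [Set.mem_setOf_eq, Pi.neg_apply, Finset.sum_neg_distrib] at *
    rw [ha, neg_zero]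

/-- `V` as a subgroup of the wreath product. -/
def Vfull (p n : ℕ) : Subgroup (Wreath p n) := SemidirectProduct.inl.range

/-- `V⁺`, the constant tuples, as a subgroup of the wreath product. -/
def Vplus (p n : ℕ) : Subgroup (Wreath p n) :=
  (AddSubgroup.toSubgroup (constTuples p n)).map SemidirectProduct.inl

/-- `V⁻`, the tuples with coordinate sum `0`, as a subgroup of the wreath product. -/
def Vminus (p n : ℕ) : Subgroup (Wreath p n) :=
  (AddSubgroup.toSubgroup (sumZero p n)).map SemidirectProduct.inl

/-- `B = Sym_n` as a subgroup of the wreath product. -/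
def Bsub (p n : ℕ) : Subgroup (Wreath p n) := SemidirectProduct.inr.range

/-- A group `G` acting on `X` acts *preprimitively* if the action is pretransitive and
every block is trivial. -/
def Preprimitive (G : Type*) (X : Type*) [Group G] [MulAction G X] : Prop :=
  MulAction.IsPretransitive G X ∧
    ∀ B : Set X, MulAction.IsBlock G B → MulAction.IsTrivialBlock B

/-- The projection of a direct product of wreath products `ℤ_{p i} ≀ Sym_{n i}` onto the
product `B = ∏ Sym_{n i}`. -/
def projB {t : ℕ} (p n : Fin t → ℕ) :
    (∀ i, Wreath (p i) (n i)) →* (∀ i, Equiv.Perm (Fin (n i))) :=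
  MonoidHom.mk' (fun g i => (g i).right) (fun _ _ => rfl)

/-- The projection onto the `i`-th factor. -/
abbrev projG {t : ℕ} (p n : Fin t → ℕ) (i : Fin t) :
    (∀ j, Wreath (p j) (n j)) →* Wreath (p i) (n i) :=
  Pi.evalMonoidHom _ i

section Pronormal

variable {G G' : Type*} [Group G] [Group G']

theorem Subgroup.map_map_conj (f : G →* G') (S : Subgroup G) (g : G) :
    (S.map (MulAut.conj g).toMonoidHom).map f =
      (S.map f).map (MulAut.conj (f g)).toMonoidHom := by
  rw [Subgroup.map_map, Subgroup.map_map]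
  congr 1
  ext x
  simp

theorem Subgroup.map_conj_mul (S : Subgroup G) (a b : G) :
    S.map (MulAut.conj (a * b)).toMonoidHom =
      (S.map (MulAut.conj b).toMonoidHom).map (MulAut.conj a).toMonoidHom := by
  rw [Subgroup.map_map]
  congr 1
  ext x
  simp [mul_assoc]

theorem Subgroup.map_conj_eq_self {S : Subgroup G} {d : G}
    (h : ∀ k ∈ S, d * k * d⁻¹ ∈ S) (h' : ∀ k ∈ S, d⁻¹ * k * d ∈ S) :
    S.map (MulAut.conj d).toMonoidHom = S := by
  ext x
  constructor
  · rintro ⟨k, hk, rfl⟩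
    simpa using h k hk
  · intro hx
    exact ⟨d⁻¹ * x * d, h' x hx, by simp [mul_assoc]⟩

theorem Subgroup.map_conj_of_mem {S : Subgroup G} {d : G} (hd : d ∈ S) :
    S.map (MulAut.conj d).toMonoidHom = S :=
  Subgroup.map_conj_eq_self
    (fun _ hk => S.mul_mem (S.mul_mem hd hk) (S.inv_mem hd))
    (fun _ hk => S.mul_mem (S.mul_mem (S.inv_mem hd) hk) hd)

theorem isPronormal_subgroupOf_iff {H K : Subgroup G} (hHK : H ≤ K) :
    IsPronormal (H.subgroupOf K) ↔
      ∀ g ∈ K, ∃ x ∈ H ⊔ H.map (MulAut.conj g).toMonoidHom,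
        H.map (MulAut.conj x).toMonoidHom = H.map (MulAut.conj g).toMonoidHom := by
  have hmap : (H.subgroupOf K).map K.subtype = H := Subgroup.map_subgroupOf_eq_of_le hHK
  have hconj (g : K) : ((H.subgroupOf K).map (MulAut.conj g).toMonoidHom).map K.subtype =
      H.map (MulAut.conj (g : G)).toMonoidHom := by
    rw [Subgroup.map_map_conj, hmap]; rfl
  have hsup (g : K) : (H.subgroupOf K ⊔
      (H.subgroupOf K).map (MulAut.conj g).toMonoidHom).map K.subtype =
      H ⊔ H.map (MulAut.conj (g : G)).toMonoidHom := by
    rw [Subgroup.map_sup, hconj, hmap]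
  constructor
  · intro h g hg
    obtain ⟨x, hx, hxg⟩ := h ⟨g, hg⟩
    refine ⟨x, ?_, ?_⟩
    · rw [← hsup ⟨g, hg⟩]
      exact ⟨x, hx, rfl⟩
    · rw [← hconj x, hxg, hconj]
  · intro h g
    obtain ⟨x, hx, hxg⟩ := h g g.2
    rw [← hsup g] at hx
    obtain ⟨y, hy, rfl⟩ := hx
    refine ⟨y, hy, Subgroup.map_injective K.subtype_injective ?_⟩
    rw [hconj, hconj]
    exact hxg

theorem IsPronormal.map_subgroupOf {H K : Subgroup G} (hHK : H ≤ K) (f : G →* G')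
    (h : IsPronormal (H.subgroupOf K)) : IsPronormal ((H.map f).subgroupOf (K.map f)) := by
  rw [isPronormal_subgroupOf_iff hHK] at h
  rw [isPronormal_subgroupOf_iff (Subgroup.map_mono hHK)]
  rintro _ ⟨g, hg, rfl⟩
  obtain ⟨x, hx, hxg⟩ := h g hg
  refine ⟨f x, ?_, ?_⟩
  · rw [← Subgroup.map_map_conj, ← Subgroup.map_sup]
    exact ⟨x, hx, rfl⟩
  · rw [← Subgroup.map_map_conj, hxg, Subgroup.map_map_conj]

end Pronormal

section Pi

variable {ι : Type*} [DecidableEq ι] {G : ι → Type*} [∀ i, Group (G i)]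

open scoped commutatorElement

/-- A subgroup covering every factor modulo abelian normal subgroups `A i` covers the whole
product modulo `∏ A i`. -/
theorem exists_mul_of_forall_cover [Finite ι] {A : ∀ i, Subgroup (G i)} [∀ i, (A i).Normal]
    {H : Subgroup (∀ i, G i)}
    (hcover : ∀ i (g : G i), ∃ k ∈ H, k⁻¹ * Pi.mulSingle i g ∈ Subgroup.pi Set.univ A)
    (g : ∀ i, G i) : ∃ u ∈ Subgroup.pi Set.univ A, ∃ h ∈ H, u * h = g := by
  have hn : (Subgroup.pi Set.univ A).Normal :=
    ⟨fun n hn g i hi => (inferInstance : (A i).Normal).conj_mem _ (hn i hi) _⟩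
  rw [← Subgroup.mem_sup_of_normal_left]
  refine Subgroup.pi_mem_of_mulSingle_mem g fun i => ?_
  obtain ⟨k, hk, hkA⟩ := hcover i (g i)
  rw [← mul_inv_cancel_left k (Pi.mulSingle i (g i))]
  exact mul_mem (Subgroup.mem_sup_right hk) (Subgroup.mem_sup_left hkA)

theorem mul_mul_inv_eq_of_inv_mul_mem {G : Type*} [Group G] {A : Subgroup G}
    (hA : ∀ a ∈ A, ∀ b ∈ A, a * b = b * a) {g a b : G} (hb : b ∈ A) (h : g⁻¹ * a ∈ A) :
    a * b * a⁻¹ = g * b * g⁻¹ := by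
  have := hA _ h _ hb
  have h1 : a = g * (g⁻¹ * a) := by group
  calc a * b * a⁻¹ = g * (g⁻¹ * a * b) * a⁻¹ := by group
    _ = g * b * g⁻¹ := by rw [this]; group

theorem mul_mulSingle_mul_inv {A : ∀ i, Subgroup (G i)}
    (hA : ∀ i, ∀ a ∈ A i, ∀ b ∈ A i, a * b = b * a) {i : ι} {g : G i} {k : ∀ i, G i}
    (hk : k⁻¹ * Pi.mulSingle i g ∈ Subgroup.pi Set.univ A) {a : G i} (ha : a ∈ A i) :
    k * Pi.mulSingle i a * k⁻¹ = Pi.mulSingle i (g * a * g⁻¹) := by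
  funext j
  have hj := hk j trivial
  by_cases hij : j = i
  · subst hij
    simp only [Pi.mul_apply, Pi.inv_apply, Pi.mulSingle_eq_same] at hj ⊢
    exact (mul_mul_inv_eq_of_inv_mul_mem (hA j) ha hj).symm
  · simp [Pi.mulSingle_eq_of_ne hij]

theorem commutator_eq_mulSingle {A : ∀ i, Subgroup (G i)}
    (hA : ∀ i, ∀ a ∈ A i, ∀ b ∈ A i, a * b = b * a) {i : ι} {g : G i} {k d : ∀ i, G i}
    (hk : k⁻¹ * Pi.mulSingle i g ∈ Subgroup.pi Set.univ A) (hd : d ∈ Subgroup.pi Set.univ A) :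
    ⁅k, d⁆ = Pi.mulSingle i ⁅g, d i⁆ := by
  funext j
  have hj := hk j trivial
  have hdj := hd j trivial
  by_cases hij : j = i
  · subst hij
    simp only [Pi.mul_apply, Pi.inv_apply, Pi.mulSingle_eq_same, commutatorElement_def] at hj ⊢
    rw [mul_mul_inv_eq_of_inv_mul_mem (hA j) hdj hj]
  · simp only [Pi.mul_apply, Pi.inv_apply, Pi.mulSingle_eq_of_ne hij, mul_one,
      commutatorElement_def] at hj ⊢
    rw [← mul_mul_inv_eq_of_inv_mul_mem (a := 1) (hA j) hdj (by simpa using hj)]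
    simp

theorem isPronormal_of_forall_proj [Finite ι] {A : ∀ i, Subgroup (G i)} [∀ i, (A i).Normal]
    (hA : ∀ i, ∀ a ∈ A i, ∀ b ∈ A i, a * b = b * a)
    {H K : Subgroup (∀ i, G i)} (hHK : H ≤ K)
    (hcover : ∀ i (g : G i), ∃ k ∈ H, k⁻¹ * Pi.mulSingle i g ∈ Subgroup.pi Set.univ A)
    (hcomm : ∀ i, ∀ d ∈ A i, (∀ g : G i, ⁅g, d⁆ ∈ H.map (Pi.evalMonoidHom G i)) →
      ∀ g : G i, Pi.mulSingle i ⁅g, d⁆ ∈ H)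
    (h : ∀ i, IsPronormal ((H.map (Pi.evalMonoidHom G i)).subgroupOf
      (K.map (Pi.evalMonoidHom G i)))) :
    IsPronormal (H.subgroupOf K) := by
  simp_rw [isPronormal_subgroupOf_iff (Subgroup.map_mono hHK)] at h
  rw [isPronormal_subgroupOf_iff hHK]
  intro g hg
  obtain ⟨u, hu, k, hk, rfl⟩ := exists_mul_of_forall_cover hcover g
  have huK : u ∈ K := by simpa using K.mul_mem hg (K.inv_mem (hHK hk))
  rw [Subgroup.map_conj_mul, Subgroup.map_conj_of_mem hk]
  have huA (i) : u i ∈ A i := hu i trivial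
  set M := H ⊔ H.map (MulAut.conj u).toMonoidHom
  -- elements of `A i` lying in `M`
  let Y (i) : Subgroup (G i) := M.comap (MonoidHom.mulSingle G i) ⊓ A i
  have hYn (i) : (Y i).Normal := by
    refine ⟨fun y hy g => ⟨?_, (inferInstance : (A i).Normal).conj_mem _ hy.2 _⟩⟩
    obtain ⟨k, hk, hkA⟩ := hcover i g
    have hkM : k ∈ M := Subgroup.mem_sup_left hk
    have := M.mul_mem (M.mul_mem hkM hy.1) (M.inv_mem hkM)
    rwa [MonoidHom.mulSingle_apply, mul_mulSingle_mul_inv hA hkA hy.2] at this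
  have hYu (i) (g : G i) : ⁅g, u i⁆ ∈ Y i := by
    obtain ⟨k, hk, hkA⟩ := hcover i g
    refine ⟨?_, (A i).mul_mem ((inferInstance : (A i).Normal).conj_mem _ (huA i) _)
      ((A i).inv_mem (huA i))⟩
    change Pi.mulSingle i ⁅g, u i⁆ ∈ M
    rw [← commutator_eq_mulSingle hA hkA hu, commutatorElement_def, mul_assoc, mul_assoc,
      ← mul_assoc u]
    exact mul_mem (Subgroup.mem_sup_left hk)
      (Subgroup.mem_sup_right ⟨k⁻¹, inv_mem hk, by simp⟩)
  have key (i) : ∃ y ∈ Y i, ∀ g : G i, Pi.mulSingle i ⁅g, y⁻¹ * u i⁆ ∈ H := by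
    obtain ⟨x, hx, hxu⟩ := h i (u i) ⟨u, huK, rfl⟩
    have hle : H.map (Pi.evalMonoidHom G i) ⊔
        (H.map (Pi.evalMonoidHom G i)).map (MulAut.conj (u i)).toMonoidHom ≤
        Y i ⊔ H.map (Pi.evalMonoidHom G i) := by
      refine sup_le le_sup_right ?_
      rintro _ ⟨a, ha, rfl⟩
      have h1 : u i * a * (u i)⁻¹ = ⁅a, u i⁆⁻¹ * a := by
        rw [commutatorElement_def]; group
      change u i * a * (u i)⁻¹ ∈ _
      rw [h1]
      exact mul_mem (Subgroup.mem_sup_left (inv_mem (hYu i a))) (Subgroup.mem_sup_right ha)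
    obtain ⟨y, hy, a, ha, rfl⟩ := Subgroup.mem_sup_of_normal_left.1 (hle hx)
    rw [Subgroup.map_conj_mul, Subgroup.map_conj_of_mem ha] at hxu
    refine ⟨y, hy, hcomm i _ (mul_mem (inv_mem hy.2) (huA i)) fun g => ?_⟩
    obtain ⟨k, hk, hkA⟩ := hcover i g
    have hki := hkA i trivial
    simp only [Pi.mul_apply, Pi.inv_apply, Pi.mulSingle_eq_same] at hki
    have hkH : k i ∈ H.map (Pi.evalMonoidHom G i) := ⟨k, hk, rfl⟩
    rw [commutatorElement_def, mul_mul_inv_eq_of_inv_mul_mem (hA i)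
      (mul_mem (inv_mem hy.2) (huA i)) hki, mul_assoc, mul_assoc]
    refine mul_mem hkH ?_
    have h2 : u i * (k i)⁻¹ * (u i)⁻¹ ∈
        (H.map (Pi.evalMonoidHom G i)).map (MulAut.conj y).toMonoidHom := by
      rw [hxu]
      exact ⟨(k i)⁻¹, inv_mem hkH, rfl⟩
    obtain ⟨b, hb, hbu⟩ := h2
    have hbu' : y * b * y⁻¹ = u i * (k i)⁻¹ * (u i)⁻¹ := hbu
    have h3 : y⁻¹ * u i * ((k i)⁻¹ * (y⁻¹ * u i)⁻¹) = b := calc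
      _ = y⁻¹ * (u i * (k i)⁻¹ * (u i)⁻¹) * y := by group
      _ = b := by rw [← hbu']; group
    rw [h3]
    exact hb
  choose y hyY hy using key
  refine ⟨y, Subgroup.pi_mem_of_mulSingle_mem y fun i => (hyY i).1, ?_⟩
  obtain ⟨d, rfl⟩ : ∃ d, u = y * d := ⟨y⁻¹ * u, by group⟩
  have hdA (i) : d i ∈ A i := by
    simpa using (A i).mul_mem ((A i).inv_mem (hyY i).2) (huA i)
  have hd (k : ∀ i, G i) : ⁅k, d⁆ ∈ H := by
    refine Subgroup.pi_mem_of_mulSingle_mem _ fun i => ?_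
    have hi := hy i (k i)
    rwa [Pi.mul_apply, inv_mul_cancel_left] at hi
  rw [Subgroup.map_conj_mul, Subgroup.map_conj_eq_self (d := d)]
  · intro k hk
    have h1 : d * k * d⁻¹ = ⁅k, d⁆⁻¹ * k := by rw [commutatorElement_def]; group
    rw [h1]
    exact mul_mem (inv_mem (hd k)) hk
  · intro k hk
    have h1 : d⁻¹ * k * d = ⁅k, d⁆ * k := by
      funext i
      have := hA i _ ((A i).inv_mem (hdA i)) _
        ((inferInstance : (A i).Normal).conj_mem _ (hdA i) (k i))
      simp only [commutatorElement_def, Pi.mul_apply, Pi.inv_apply]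
      rw [← this]; group
    rw [h1]
    exact mul_mem (hd k) hk

end Pi

theorem Subgroup.exists_conj_mem_of_odd_index {G : Type*} [Group G] {H : Subgroup G}
    (hH : Odd H.index) {τ : G} (hτ : τ ^ 2 = 1) : ∃ g, g⁻¹ * τ * g ∈ H := by
  have : Fact (Nat.Prime 2) := ⟨Nat.prime_two⟩
  have hp : IsPGroup 2 (Subgroup.zpowers τ) := by
    rintro ⟨_, m, rfl⟩
    refine ⟨1, Subtype.ext ?_⟩
    change (τ ^ m) ^ 2 ^ 1 = 1
    rw [pow_one, ← zpow_natCast, zpow_comm, zpow_natCast, hτ, one_zpow]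
  obtain ⟨q, hq⟩ := hp.nonempty_fixed_point_of_prime_not_dvd_card (G ⧸ H)
    (by rw [← Subgroup.index_eq_card]; exact hH.not_two_dvd_nat)
  obtain ⟨g, rfl⟩ := QuotientGroup.mk_surjective q
  refine ⟨g, ?_⟩
  have h1 : ((τ * g : G) : G ⧸ H) = g := hq ⟨τ, Subgroup.mem_zpowers τ⟩
  rw [eq_comm, QuotientGroup.eq] at h1
  rwa [mul_assoc]

theorem Equiv.Perm.eq_top_of_normal_of_isSwap_mem {α : Type*} [Finite α] [DecidableEq α]
    {N : Subgroup (Equiv.Perm α)} (hN : N.Normal) {s : Equiv.Perm α} (hs : s.IsSwap)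
    (hsN : s ∈ N) : N = ⊤ := by
  rw [eq_top_iff, ← Equiv.Perm.closure_isSwap, Subgroup.closure_le]
  rintro _ ⟨x, y, hxy, rfl⟩
  obtain ⟨a, b, hab, rfl⟩ := hs
  obtain ⟨c, hc⟩ := isConj_iff.1 (Equiv.Perm.isConj_swap hab hxy)
  rw [← hc]
  exact hN.conj_mem _ hsN c

section Tuples

variable {α R : Type*} [DecidableEq α]

theorem comp_swap_sub_self [AddCommGroup R] (v : α → R) {a b : α} (hab : a ≠ b) :
    v ∘ Equiv.swap a b - v = Pi.single a (v b - v a) - Pi.single b (v b - v a) := by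
  funext x
  by_cases hxa : x = a
  · subst hxa
    simp [hab]
  · by_cases hxb : x = b
    · subst hxb
      simp [hxa]
    · simp [hxa, hxb, Equiv.swap_apply_of_ne_of_ne]

theorem AddSubgroup.comp_perm_sub_self_mem [Finite α] {p : ℕ} [Fact p.Prime]
    {W : AddSubgroup (α → ZMod p)}
    (hW : ∀ w ∈ W, ∀ σ : Equiv.Perm α, w ∘ σ ∈ W) {a b : α} (hab : a ≠ b) {c : ZMod p}
    (hc : c ≠ 0) (h : Pi.single a c - Pi.single b c ∈ W) (d : α → ZMod p)
    (σ : Equiv.Perm α) : d ∘ σ - d ∈ W := by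
  have hab' (e : ZMod p) : Pi.single a e - Pi.single b e ∈ W := by
    have h1 := W.nsmul_mem h (e / c).val
    convert h1 using 1
    rw [← Nat.cast_smul_eq_nsmul (ZMod p), ZMod.natCast_zmod_val, smul_sub, ← Pi.single_smul,
      ← Pi.single_smul, smul_eq_mul, div_mul_cancel₀ _ hc]
  have hxy (x y : α) (hxy : x ≠ y) (e : ZMod p) : Pi.single x e - Pi.single y e ∈ W := by
    set τ : Equiv.Perm α := Equiv.swap (Equiv.swap x a y) b * Equiv.swap x a with hτ
    have hya : Equiv.swap x a y ≠ a := fun h => hxy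
      ((Equiv.swap x a).injective (by rw [h, Equiv.swap_apply_left]))
    have hx : τ x = a := by
      rw [hτ, Equiv.Perm.mul_apply, Equiv.swap_apply_left,
        Equiv.swap_apply_of_ne_of_ne hya.symm hab]
    have hy : τ y = b := by
      rw [hτ, Equiv.Perm.mul_apply, Equiv.swap_apply_left]
    convert hW _ (hab' e) τ using 1
    funext z
    simp only [Pi.sub_apply, Function.comp_apply, Pi.single_apply, ← hx, ← hy,
      EmbeddingLike.apply_eq_iff_eq]
  induction σ using Equiv.Perm.swap_induction_on generalizing d with
  | one => simp
  | swap_mul f x y hne ih =>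
    have h1 : d ∘ ⇑(Equiv.swap x y * f) - d =
        ((d ∘ Equiv.swap x y) ∘ f - d ∘ Equiv.swap x y) + (d ∘ Equiv.swap x y - d) := by
      rw [sub_add_sub_cancel]; rfl
    rw [h1]
    refine add_mem (ih _) ?_
    rw [comp_swap_sub_self d hne]
    exact hxy x y hne _

end Tuples

section Wreath

open scoped commutatorElement

theorem mul_comm_of_mem_ker_rightHom {p n : ℕ} {a b : Wreath p n}
    (ha : a ∈ (SemidirectProduct.rightHom : Wreath p n →* _).ker)
    (hb : b ∈ (SemidirectProduct.rightHom : Wreath p n →* _).ker) : a * b = b * a := by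
  rw [← SemidirectProduct.range_inl_eq_ker_rightHom] at ha hb
  obtain ⟨v, rfl⟩ := ha
  obtain ⟨w, rfl⟩ := hb
  rw [← map_mul, mul_comm, map_mul]

theorem commutator_inl {p n : ℕ} (g : Wreath p n) (v : Fin n → ZMod p) :
    ⁅g, (SemidirectProduct.inl (Multiplicative.ofAdd v) : Wreath p n)⁆ =
      SemidirectProduct.inl (Multiplicative.ofAdd (v ∘ ⇑g.right⁻¹ - v)) := by
  have h1 : permAction n (ZMod p) g.right (Multiplicative.ofAdd v) =
    Multiplicative.ofAdd (v ∘ ⇑g.right⁻¹) := rfl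
  rw [ofAdd_sub, ← h1, div_eq_mul_inv, map_mul, SemidirectProduct.inl_aut, map_inv,
    commutatorElement_def]
  congr 1
  refine mul_mul_inv_eq_of_inv_mul_mem (fun _ ha _ hb => mul_comm_of_mem_ker_rightHom ha hb) ?_ ?_
  · simp [MonoidHom.mem_ker]
  · simp [MonoidHom.mem_ker]

theorem commutator_inl_of_right_eq_swap {p n : ℕ} {g : Wreath p n} {a b : Fin n} (hab : a ≠ b)
    (hg : g.right = Equiv.swap a b) (v : Fin n → ZMod p) :
    ⁅g, (SemidirectProduct.inl (Multiplicative.ofAdd v) : Wreath p n)⁆ =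
      SemidirectProduct.inl (Multiplicative.ofAdd
        (Pi.single a (v b - v a) - Pi.single b (v b - v a))) := by
  rw [commutator_inl, hg, Equiv.swap_inv, comp_swap_sub_self v hab]

theorem inv_mul_mulSingle_mem_pi_ker {t : ℕ} {p n : Fin t → ℕ} {i : Fin t}
    {g : Wreath (p i) (n i)} {k : ∀ j, Wreath (p j) (n j)}
    (hk : projB p n k = Pi.mulSingle i g.right) :
    k⁻¹ * Pi.mulSingle i g ∈ Subgroup.pi Set.univ
      fun j => (SemidirectProduct.rightHom : Wreath (p j) (n j) →* _).ker := by
  intro j _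
  have hkj : (k j).right = (Pi.mulSingle i g.right : ∀ j, Equiv.Perm (Fin (n j))) j :=
    congrFun hk j
  refine MonoidHom.mem_ker.2 ?_
  by_cases hj : j = i
  · subst hj
    simp [hkj]
  · simp [hkj, hj]

theorem exists_mem_projB_eq_mulSingle {t : ℕ} {p n : Fin t → ℕ}
    {H : Subgroup (∀ i, Wreath (p i) (n i))} (hH : Odd H.index)
    (hprim : ∀ i, Preprimitive
      ↥((H.map (projG p n i)).map SemidirectProduct.rightHom) (Fin (n i)))
    (i : Fin t) (σ : Equiv.Perm (Fin (n i))) :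
    ∃ k ∈ H, projB p n k = Pi.mulSingle i σ := by
  rcases subsingleton_or_nontrivial (Fin (n i)) with hs | hs
  · refine ⟨1, H.one_mem, ?_⟩
    rw [Subsingleton.elim σ 1, map_one, Pi.mulSingle_one]
  obtain ⟨a, b, hab⟩ := exists_pair_ne (Fin (n i))
  obtain ⟨g, hg⟩ := Subgroup.exists_conj_mem_of_odd_index hH
    (τ := Pi.mulSingle i (SemidirectProduct.inr (Equiv.swap a b))) (by
      rw [← Pi.mulSingle_pow, ← map_pow, pow_two, Equiv.swap_mul_self, map_one,
        Pi.mulSingle_one])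
  set s := (g i).right⁻¹ * Equiv.swap a b * (g i).right with hs_def
  have hproj : projB p n (g⁻¹ * Pi.mulSingle i (SemidirectProduct.inr (Equiv.swap a b)) * g) =
      Pi.mulSingle i s := by
    rw [map_mul, map_mul, map_inv]
    funext j
    by_cases hj : j = i
    · subst hj
      simp [projB, s]
    · simp [projB, hj]
  have hswap : s.IsSwap := by
    refine ⟨(g i).right⁻¹ a, (g i).right⁻¹ b, by simpa using hab, ?_⟩
    rw [hs_def, Equiv.swap_apply_apply, inv_inv]
  have htop : (H.map (projG p n i)).map SemidirectProduct.rightHom = ⊤ := by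
    obtain ⟨h1, h2⟩ := hprim i
    refine Equiv.Perm.subgroup_eq_top_of_isPreprimitive_of_isSwap_mem
      { isTrivialBlock_of_isBlock := fun {B} => h2 B } s hswap
      ⟨_, ⟨_, hg, rfl⟩, ?_⟩
    have hi := congrFun hproj i
    rw [Pi.mulSingle_eq_same] at hi
    exact hi
  let N := (H.map (projB p n)).comap (MonoidHom.mulSingle (fun i => Equiv.Perm (Fin (n i))) i)
  have hN : N = ⊤ := by
    refine Equiv.Perm.eq_top_of_normal_of_isSwap_mem ⟨?_⟩ hswap ⟨_, hg, hproj⟩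
    rintro x ⟨k, hk, hkx⟩ y
    have hy : y ∈ (H.map (projG p n i)).map SemidirectProduct.rightHom :=
      htop ▸ Subgroup.mem_top y
    obtain ⟨_, ⟨l, hl, rfl⟩, rfl⟩ := hy
    refine ⟨l * k * l⁻¹, H.mul_mem (H.mul_mem hl hk) (H.inv_mem hl), ?_⟩
    rw [map_mul, map_mul, map_inv, hkx]
    funext j
    by_cases hj : j = i
    · subst hj
      simp [projB]
    · simp [projB, hj]
  exact (hN ▸ Subgroup.mem_top σ : σ ∈ N)

theorem mulSingle_commutator_mem {t : ℕ} {p n : Fin t → ℕ}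
    (hp : ∀ i, (p i).Prime) (hodd : ∀ i, Odd (p i))
    {H : Subgroup (∀ i, Wreath (p i) (n i))}
    (hcover : ∀ i (σ : Equiv.Perm (Fin (n i))), ∃ k ∈ H, projB p n k = Pi.mulSingle i σ)
    {i : Fin t} {d : Wreath (p i) (n i)}
    (hd : d ∈ (SemidirectProduct.rightHom : Wreath (p i) (n i) →* _).ker)
    (hdH : ∀ g : Wreath (p i) (n i), ⁅g, d⁆ ∈ H.map (projG p n i)) (g : Wreath (p i) (n i)) :
    Pi.mulSingle i ⁅g, d⁆ ∈ H := by
  rw [← SemidirectProduct.range_inl_eq_ker_rightHom] at hd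
  obtain ⟨v, rfl⟩ := hd
  obtain ⟨v, rfl⟩ := Multiplicative.ofAdd.surjective v
  by_cases hconst : ∀ a b, v a = v b
  · rw [commutator_inl]
    have h1 : v ∘ ⇑g.right⁻¹ - v = 0 := by
      funext x
      simp [hconst _ x]
    rw [h1, ofAdd_zero, map_one, Pi.mulSingle_one]
    exact H.one_mem
  push Not at hconst
  obtain ⟨a, b, hvab⟩ := hconst
  have hab : a ≠ b := fun h => hvab (h ▸ rfl)
  have : Fact (p i).Prime := ⟨hp i⟩
  set c := v b - v a with hc_def
  have hc : c ≠ 0 := sub_ne_zero.2 hvab.symm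
  obtain ⟨k, hk, hkp⟩ := hcover i (Equiv.swap a b)
  have hki : (k i).right = Equiv.swap a b := by
    simpa [projB] using congrFun hkp i
  have hkj (j) (hj : j ≠ i) : (k j).right = 1 := by
    simpa [projB, hj] using congrFun hkp j
  obtain ⟨h, hh, hhi⟩ := hdH (k i)
  rw [commutator_inl_of_right_eq_swap hab hki] at hhi
  change h i = _ at hhi
  have hw : ⁅k, h⁆ ∈ H := by
    rw [commutatorElement_def]
    exact mul_mem (mul_mem (mul_mem hk hh) (inv_mem hk)) (inv_mem hh)
  have hker : ⁅k, h⁆ ∈ Subgroup.pi Set.univ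
      fun j => (SemidirectProduct.rightHom : Wreath (p j) (n j) →* _).ker := by
    intro j _
    refine MonoidHom.mem_ker.2 ?_
    by_cases hj : j = i
    · subst hj
      have hhj : (h j).right = 1 := by rw [hhi, SemidirectProduct.right_inl]
      simp [commutatorElement_def, hhj]
    · simp [commutatorElement_def, hkj j hj]
  have hcomm := commutator_eq_mulSingle (i := i) (g := k i) (k := k)
    (fun j a ha b hb => mul_comm_of_mem_ker_rightHom (a := a) (b := b) ha hb)
    (inv_mul_mulSingle_mem_pi_ker (by rw [hkp, hki])) hker
  have hki' : ⁅k, h⁆ i = ⁅k i, h i⁆ := rfl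
  rw [hki', hhi, commutator_inl_of_right_eq_swap hab hki,
    commutator_inl_of_right_eq_swap hab hki] at hcomm
  let W : AddSubgroup (Fin (n i) → ZMod (p i)) := Subgroup.toAddSubgroup' (H.comap
    ((MonoidHom.mulSingle (fun j => Wreath (p j) (n j)) i).comp SemidirectProduct.inl))
  have hW (w) (hw : w ∈ W) (σ : Equiv.Perm (Fin (n i))) : w ∘ σ ∈ W := by
    obtain ⟨l, hl, hlp⟩ := hcover i σ⁻¹
    have hmul := mul_mulSingle_mul_inv (i := i) (g := SemidirectProduct.inr σ⁻¹) (k := l)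
      (a := SemidirectProduct.inl (Multiplicative.ofAdd w))
      (fun j a ha b hb => mul_comm_of_mem_ker_rightHom (a := a) (b := b) ha hb)
      (inv_mul_mulSingle_mem_pi_ker hlp) (by simp [MonoidHom.mem_ker])
    rw [← map_inv, ← SemidirectProduct.inl_aut] at hmul
    have hmem := mul_mem (mul_mem hl (show Pi.mulSingle i _ ∈ H from hw)) (inv_mem hl)
    erw [hmul] at hmem
    exact hmem
  have hmem := AddSubgroup.comp_perm_sub_self_mem (W := W) hW hab (c := 4 * c) ?_ ?_ v g.right⁻¹
  · rw [commutator_inl]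
    exact hmem
  · have h2 : (2 : ZMod (p i)) ≠ 0 := by
      have : (2 : ZMod (p i)) = ((2 : ℕ) : ZMod (p i)) := by norm_num
      rw [this, Ne, ZMod.natCast_eq_zero_iff, Nat.prime_dvd_prime_iff_eq (hp i) Nat.prime_two]
      intro h2
      have := hodd i
      rw [h2] at this
      exact absurd this (by decide)
    have h4 : (4 : ZMod (p i)) = 2 * 2 := by norm_num
    rw [h4]
    exact mul_ne_zero (mul_ne_zero h2 h2) hc
  · change Pi.mulSingle i (SemidirectProduct.inl (Multiplicative.ofAdd _)) ∈ H
    convert mul_mem (mul_mem (mul_mem hk hw) (inv_mem hk)) (inv_mem hw) using 1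
    rw [← commutatorElement_def, hcomm]
    congr 4 <;> simp [hab, hab.symm] <;> linear_combination 4 * hc_def

end Wreath

/-- Let `H` be a nontrivial subgroup of odd index in `G = ∏ (ℤ_{p i} ≀ Sym_{n i})` (all
`p i` odd primes) whose projections into the symmetric groups act preprimitively. Then
for every `K` with `H ≤ K ≤ G`, `H` is pronormal in `K` if and only if for each `i` the
projection `π_i(H)` is pronormal in `π_i(K)`. -/
theorem pronormal_iff_proj_pronormal (t : ℕ) (ht : 0 < t) (p n : Fin t → ℕ)
    (hp : ∀ i, (p i).Prime) (hodd : ∀ i, Odd (p i)) (hn : ∀ i, 0 < n i)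
    (H : Subgroup (∀ i, Wreath (p i) (n i))) (hne : H ≠ ⊥) (hH : Odd H.index)
    (hprim : ∀ i, Preprimitive
      ↥((H.map (projG p n i)).map SemidirectProduct.rightHom) (Fin (n i)))
    (K : Subgroup (∀ i, Wreath (p i) (n i))) (hHK : H ≤ K) :
    IsPronormal (H.subgroupOf K) ↔
      ∀ i, IsPronormal ((H.map (projG p n i)).subgroupOf (K.map (projG p n i))) := by
  refine ⟨fun h i => h.map_subgroupOf hHK _, ?_⟩
  have hcover := exists_mem_projB_eq_mulSingle hH hprim
  refine isPronormal_of_forall_proj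
    (A := fun i => (SemidirectProduct.rightHom : Wreath (p i) (n i) →* _).ker)
    (fun _ _ ha _ hb => mul_comm_of_mem_ker_rightHom ha hb) hHK (fun i g => ?_)
    (fun i d hd hdH g => mulSingle_commutator_mem hp hodd hcover hd hdH g)
  obtain ⟨k, hk, hkp⟩ := hcover i g.right
  exact ⟨k, hk, inv_mul_mulSingle_mem_pi_ker hkp⟩
end

section
/- Let p be an odd prime and n a positive integer, and let G = ℤ_p ≀ Sym_n = V ⋊ B as described. Let H be a subgroup of G with H̄ = B (H projects onto Sym_n). If K is a proper subgroup of G with H ≤ K, then H is pronormal in K. -/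
/-- A permutation-invariant additive subgroup of `ℤ_p^n` containing a non-constant tuple contains
all tuples with coordinate sum `0`. -/
theorem sumZero_le_of_nonconstant {p n : ℕ} [Fact p.Prime] {S : AddSubgroup (Fin n → ZMod p)}
    (hS : ∀ (σ : Equiv.Perm (Fin n)), ∀ v ∈ S, v ∘ σ ∈ S) {v : Fin n → ZMod p} (hv : v ∈ S)
    {i j : Fin n} (hij : v i ≠ v j) : sumZero p n ≤ S := by
  have hne : i ≠ j := fun h => hij (by rw [h])
  have hsmul : ∀ (a : ZMod p), ∀ w ∈ S, a • w ∈ S := fun a w hw => ZMod.smul_mem hw a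
  have hbase : (Pi.single i 1 - Pi.single j 1 : Fin n → ZMod p) ∈ S := by
    have h := hsmul (v i - v j)⁻¹ _ (S.sub_mem hv (hS (Equiv.swap i j) v hv))
    convert h using 1
    have hc : v i - v j ≠ 0 := sub_ne_zero.mpr hij
    ext k
    rcases eq_or_ne k i with rfl | hki
    · simp [hne, hc]
    · rcases eq_or_ne k j with rfl | hkj
      · have : (v i - v k)⁻¹ * (v k - v i) = -1 := by
          rw [← neg_sub (v i), mul_neg, inv_mul_cancel₀ hc]
        simp [hki, this]
      · simp [hki, hkj, Equiv.swap_apply_of_ne_of_ne hki hkj]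
  have hroot : ∀ k, (Pi.single k 1 - Pi.single j 1 : Fin n → ZMod p) ∈ S := by
    intro k
    rcases eq_or_ne k j with rfl | hkj
    · simp
    · convert hS (Equiv.swap i k) _ hbase using 1
      ext l
      simp only [Pi.sub_apply, Function.comp_apply, Pi.single_apply, Equiv.swap_apply_eq_iff,
        Equiv.swap_apply_left, Equiv.swap_apply_of_ne_of_ne hne.symm hkj.symm]
  intro w hw
  have hw0 : ∑ k, w k = 0 := hw
  have hsum : w = ∑ k, w k • (Pi.single k 1 - Pi.single j 1 : Fin n → ZMod p) := by
    simp only [smul_sub, Finset.sum_sub_distrib, ← Finset.sum_smul, hw0, zero_smul, sub_zero]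
    exact pi_eq_sum_univ' w
  rw [hsum]
  exact S.sum_mem fun k _ => hsmul _ _ (hroot k)

/-- The sum-zero tuples form a maximal additive subgroup of `ℤ_p^n`. -/
theorem eq_top_of_sumZero_le {p n : ℕ} [Fact p.Prime] {S : AddSubgroup (Fin n → ZMod p)}
    (hS : sumZero p n ≤ S) {v : Fin n → ZMod p} (hv : v ∈ S) (hv0 : v ∉ sumZero p n) : S = ⊤ := by
  have hs : ∑ k, v k ≠ 0 := hv0
  refine (AddSubgroup.eq_top_iff' S).mpr fun w => ?_
  have h1 : w - ((∑ k, w k) / ∑ k, v k) • v ∈ S := hS <| by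
    change ∑ k, (w - ((∑ k, w k) / ∑ k, v k) • v) k = 0
    simp [Finset.sum_sub_distrib, ← Finset.mul_sum, hs]
  have h2 : ((∑ k, w k) / ∑ k, v k) • v ∈ S := ZMod.smul_mem hv _
  simpa using S.add_mem h1 h2

/-- The tuples contained in a subgroup of the wreath product. -/
def tuplesIn {p n : ℕ} (L : Subgroup (Wreath p n)) : AddSubgroup (Fin n → ZMod p) :=
  Subgroup.toAddSubgroup' (L.comap SemidirectProduct.inl)

theorem mem_tuplesIn {p n : ℕ} {L : Subgroup (Wreath p n)} {v : Fin n → ZMod p} :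
    v ∈ tuplesIn L ↔ (SemidirectProduct.inl (Multiplicative.ofAdd v) : Wreath p n) ∈ L :=
  Iff.rfl

theorem conj_inl {p n : ℕ} (g : Wreath p n) (v : Fin n → ZMod p) :
    g * SemidirectProduct.inl (Multiplicative.ofAdd v) * g⁻¹ =
      SemidirectProduct.inl (Multiplicative.ofAdd (v ∘ g.right.symm)) := by
  ext : 1
  · simp only [SemidirectProduct.mul_left, SemidirectProduct.mul_right,
      SemidirectProduct.left_inl, SemidirectProduct.right_inl, SemidirectProduct.inv_left, mul_one,
      ← MulAut.mul_apply, ← map_mul, mul_inv_cancel, map_one, MulAut.one_apply]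
    rw [mul_right_comm, mul_inv_cancel, one_mul]
    rfl
  · simp

theorem comp_perm_mem_tuplesIn {p n : ℕ} {L : Subgroup (Wreath p n)}
    (hL : L.map SemidirectProduct.rightHom = ⊤) (σ : Equiv.Perm (Fin n)) {v : Fin n → ZMod p}
    (hv : v ∈ tuplesIn L) : v ∘ σ ∈ tuplesIn L := by
  obtain ⟨l, hl, hlσ⟩ : σ⁻¹ ∈ L.map SemidirectProduct.rightHom := hL ▸ Subgroup.mem_top _
  have h := L.mul_mem (L.mul_mem hl (mem_tuplesIn.mp hv)) (L.inv_mem hl)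
  rw [conj_inl, show l.right = σ⁻¹ from hlσ] at h
  exact h

theorem eq_top_of_tuplesIn_eq_top {p n : ℕ} {L : Subgroup (Wreath p n)}
    (hL : L.map SemidirectProduct.rightHom = ⊤) (hV : tuplesIn L = ⊤) : L = ⊤ := by
  refine (Subgroup.eq_top_iff' L).mpr fun g => ?_
  obtain ⟨l, hl, hlg⟩ : SemidirectProduct.rightHom g ∈ L.map SemidirectProduct.rightHom :=
    hL ▸ Subgroup.mem_top _
  obtain ⟨v, hv⟩ : g * l⁻¹ ∈ (SemidirectProduct.inl : _ →* Wreath p n).range := by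
    rw [SemidirectProduct.range_inl_eq_ker_rightHom, MonoidHom.mem_ker, map_mul, map_inv, hlg,
      mul_inv_cancel]
  have hvL : v.toAdd ∈ tuplesIn L := hV ▸ AddSubgroup.mem_top _
  have h : g * l⁻¹ ∈ L := hv ▸ mem_tuplesIn.mp hvL
  simpa using L.mul_mem h hl

theorem map_conj_mul_of_mem {G : Type*} [Group G] {H : Subgroup G} (x : G) {h : G} (hh : h ∈ H) :
    H.map (MulAut.conj (x * h)).toMonoidHom = H.map (MulAut.conj x).toMonoidHom := by
  have hconj : H.map (MulAut.conj h).toMonoidHom = H := Subgroup.conj_smul_eq_self_of_mem hh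
  rw [map_mul]
  conv_rhs => rw [← hconj, Subgroup.map_map]
  rfl

/-- If `p` is an odd prime and `H ≤ ℤ_p ≀ Sym_n` projects onto `Sym_n`, then `H` is
pronormal in every proper subgroup `K < ℤ_p ≀ Sym_n` containing it. -/
theorem pronormal_in_proper (p n : ℕ) (hp : p.Prime) (hodd : Odd p) (hn : 0 < n)
    (H : Subgroup (Wreath p n)) (hH : H.map SemidirectProduct.rightHom = ⊤)
    (K : Subgroup (Wreath p n)) (hHK : H ≤ K) (hK : K < ⊤) :
    IsPronormal (H.subgroupOf K) := by
  have : Fact p.Prime := ⟨hp⟩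
  intro g
  obtain ⟨h, hh, hhg⟩ : SemidirectProduct.rightHom (g : Wreath p n) ∈
      H.map SemidirectProduct.rightHom := hH ▸ Subgroup.mem_top _
  obtain ⟨u, hu⟩ : (g : Wreath p n) * h⁻¹ ∈
      (SemidirectProduct.inl : _ →* Wreath p n).range := by
    rw [SemidirectProduct.range_inl_eq_ker_rightHom, MonoidHom.mem_ker, map_mul, map_inv, hhg,
      mul_inv_cancel]
  obtain ⟨v, rfl⟩ := Multiplicative.ofAdd.surjective u
  have hproj : ∀ L : Subgroup (Wreath p n), H ≤ L → L.map SemidirectProduct.rightHom = ⊤ :=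
    fun L hL => top_le_iff.mp (hH ▸ Subgroup.map_mono hL)
  have hvK : v ∈ tuplesIn K := by
    rw [mem_tuplesIn, hu]
    exact K.mul_mem g.2 (K.inv_mem (hHK hh))
  let x : K := ⟨SemidirectProduct.inl (Multiplicative.ofAdd v), hvK⟩
  have hg : g = x * ⟨h, hHK hh⟩ := by
    ext1
    simp [x, hu]
  have hmap : (H.subgroupOf K).map (MulAut.conj g).toMonoidHom =
      (H.subgroupOf K).map (MulAut.conj x).toMonoidHom := by
    rw [hg]
    exact map_conj_mul_of_mem x (Subgroup.mem_subgroupOf.mpr hh)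
  rw [hmap]
  by_cases hconst : ∀ i j, v i = v j
  · refine ⟨1, Subgroup.one_mem _, ?_⟩
    congr 2
    rw [map_one]
    ext1 y
    have hy : (y : Wreath p n) * x * (y : Wreath p n)⁻¹ = x := by
      rw [conj_inl]
      congr 2
      exact funext fun i => hconst _ _
    have hcomm : y * x = x * y := Subtype.ext (mul_inv_eq_iff_eq_mul.mp hy)
    rw [MulAut.conj_apply, ← hcomm, mul_inv_cancel_right, MulAut.one_apply]
  · push Not at hconst
    obtain ⟨i, j, hij⟩ := hconst
    refine ⟨x, ?_, rfl⟩
    set M := H.subgroupOf K ⊔ (H.subgroupOf K).map (MulAut.conj x).toMonoidHom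
    have hHM : H ≤ M.map K.subtype := fun y hy =>
      ⟨⟨y, hHK hy⟩, le_sup_left (a := H.subgroupOf K) (Subgroup.mem_subgroupOf.mpr hy), rfl⟩
    have hvsum : v ∈ sumZero p n := by
      by_contra hv0
      refine hK.ne (eq_top_of_tuplesIn_eq_top (hproj K hHK) (eq_top_of_sumZero_le ?_ hvK hv0))
      exact sumZero_le_of_nonconstant (fun σ w => comp_perm_mem_tuplesIn (hproj K hHK) σ) hvK hij
    have hcomm : v - v ∘ Equiv.swap i j ∈ tuplesIn (M.map K.subtype) := by
      obtain ⟨s, hs, hsσ⟩ : Equiv.swap i j ∈ H.map SemidirectProduct.rightHom :=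
        hH ▸ Subgroup.mem_top _
      have hsM : (⟨s, hHK hs⟩ : K) ∈ H.subgroupOf K := Subgroup.mem_subgroupOf.mpr hs
      have h1 : x * ⟨s, hHK hs⟩ * x⁻¹ ∈ M :=
        le_sup_right (a := H.subgroupOf K) (Subgroup.mem_map_of_mem _ hsM)
      have h2 := M.mul_mem h1 (M.inv_mem (le_sup_left (a := H.subgroupOf K) hsM))
      refine mem_tuplesIn.mpr ⟨_, h2, ?_⟩
      have hs' := conj_inl s v
      rw [show s.right = Equiv.swap i j from hsσ, Equiv.symm_swap] at hs'
      rw [ofAdd_sub, map_div, ← hs']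
      simp only [x, Subgroup.coe_subtype, Subgroup.coe_mul, Subgroup.coe_inv,
        div_eq_mul_inv, mul_inv_rev, inv_inv, mul_assoc]
    have hdiff : (v - v ∘ Equiv.swap i j) i ≠ (v - v ∘ Equiv.swap i j) j := by
      have h2 : (2 : ZMod p) ≠ 0 := by
        have := ZMod.prime_ne_zero p 2 (fun h => by subst h; exact absurd hodd (by decide))
        exact_mod_cast this
      intro h
      simp only [Pi.sub_apply, Function.comp_apply, Equiv.swap_apply_left,
        Equiv.swap_apply_right] at h
      refine mul_ne_zero h2 (sub_ne_zero.mpr hij) ?_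
      linear_combination h
    have hvM : v ∈ tuplesIn (M.map K.subtype) :=
      sumZero_le_of_nonconstant (fun σ w => comp_perm_mem_tuplesIn (hproj _ hHM) σ) hcomm hdiff
        hvsum
    obtain ⟨y, hy, hyx⟩ := mem_tuplesIn.mp hvM
    rwa [show y = x from Subtype.ext hyx] at hy
end

section
/- Let p_1,…,p_t be odd primes, n_1,…,n_t positive integers, and G = ∏_{i=1}^t (ℤ_{p_i} ≀ Sym_{n_i}) = V ⋊ B as described. Let 0 ≤ t₀ ≤ t and assume that p_i does not divide n_i for 1 ≤ i ≤ t₀ and p_i divides n_i for t₀ < i ≤ t. Let R be the subgroup of G generated by B together with V_i for 1 ≤ i ≤ t₀ and V_i⁻ for t₀ < i ≤ t (so R = ∏_{i≤t₀} B_iV_i × ∏_{i>t₀} B_iV_i⁻). If H ≤ K ≤ R and H̄ = B = ∏_{i=1}^t B_i, then H is pronormal in K. -/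
/-- If every `g` factors as `x * c * h` with `x` in `⟨H, H^g⟩`, `c` centralizing `H` and `h ∈ H`,
then `H` is pronormal. -/
theorem isPronormal_of_forall_exists_commute {G : Type*} [Group G] {H : Subgroup G}
    (hH : ∀ g : G, ∃ x ∈ H ⊔ H.map (MulAut.conj g).toMonoidHom, ∃ h ∈ H,
      ∀ k ∈ H, Commute (x⁻¹ * (g * h⁻¹)) k) :
    IsPronormal H := by
  intro g
  obtain ⟨x, hx, h, hh, hc⟩ := hH g
  refine ⟨x, hx, ?_⟩
  have key : ∀ k ∈ H, g * h⁻¹ * k * (g * h⁻¹)⁻¹ = x * k * x⁻¹ := by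
    intro k hk
    have hck : x⁻¹ * (g * h⁻¹) * k = k * (x⁻¹ * (g * h⁻¹)) := hc k hk
    calc g * h⁻¹ * k * (g * h⁻¹)⁻¹
        = x * (x⁻¹ * (g * h⁻¹) * k) * (g * h⁻¹)⁻¹ := by group
      _ = x * k * x⁻¹ := by rw [hck]; group
  ext y
  simp only [Subgroup.mem_map, MulEquiv.coe_toMonoidHom, MulAut.conj_apply]
  constructor
  · rintro ⟨k, hk, rfl⟩
    refine ⟨h⁻¹ * k * h, H.mul_mem (H.mul_mem (H.inv_mem hh) hk) hh, ?_⟩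
    rw [← key k hk]
    group
  · rintro ⟨k, hk, rfl⟩
    refine ⟨h * k * h⁻¹, H.mul_mem (H.mul_mem hh hk) (H.inv_mem hh), ?_⟩
    rw [← key _ (H.mul_mem (H.mul_mem hh hk) (H.inv_mem hh))]
    group

theorem exists_perm_apply_eq_and_apply_eq {α : Type*} [DecidableEq α] {i j a b : α}
    (hij : i ≠ j) (hab : a ≠ b) : ∃ ρ : Equiv.Perm α, ρ i = a ∧ ρ j = b := by
  refine ⟨Equiv.swap (Equiv.swap i a j) b * Equiv.swap i a, ?_, by simp⟩
  have h : a ≠ Equiv.swap i a j := by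
    intro h
    apply hij
    apply (Equiv.swap i a).injective
    rw [← h, Equiv.swap_apply_left]
  rw [Equiv.Perm.mul_apply, Equiv.swap_apply_left, Equiv.swap_apply_of_ne_of_ne h hab]

/-- An additive group of tuples which contains all differences `w - w ∘ σ` of a nonconstant
tuple `w` contains all tuples with coordinate sum `0`. -/
theorem sumZero_le_of_forall_sub_comp_mem {p n : ℕ} [Fact p.Prime] {w : Fin n → ZMod p}
    {A : AddSubgroup (Fin n → ZMod p)} (hA : ∀ σ : Equiv.Perm (Fin n), w - w ∘ σ ∈ A)
    {a b : Fin n} (hab : w a ≠ w b) : sumZero p n ≤ A := by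
  have hsingle : ∀ i j, (Pi.single i 1 - Pi.single j 1 : Fin n → ZMod p) ∈ A := by
    intro i j
    rcases eq_or_ne i j with rfl | hij
    · simp
    obtain ⟨ρ, hi, hj⟩ := exists_perm_apply_eq_and_apply_eq hij (ne_of_apply_ne w hab)
    have hd := A.sub_mem (hA (ρ * Equiv.swap i j)) (hA ρ)
    convert ZMod.smul_mem hd (w a - w b)⁻¹ using 1
    have hne : w a - w b ≠ 0 := sub_ne_zero.2 hab
    ext k
    simp only [Pi.sub_apply, Pi.smul_apply, Function.comp_apply, Equiv.Perm.mul_apply,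
      smul_eq_mul, Pi.single_apply]
    rcases eq_or_ne k i with rfl | hki
    · simp only [if_true, if_neg hij, Equiv.swap_apply_left, hi, hj]
      field_simp
      ring
    rcases eq_or_ne k j with rfl | hkj
    · simp only [if_true, if_neg hki, Equiv.swap_apply_right, hi, hj]
      field_simp
      ring
    · simp [Equiv.swap_apply_of_ne_of_ne hki hkj, hki, hkj]
  intro u hu
  have hu0 : ∑ i, u i = 0 := hu
  have hsum : u = ∑ i, u i • (Pi.single i 1 - Pi.single a 1 : Fin n → ZMod p) := by
    simp only [smul_sub, Finset.sum_sub_distrib]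
    rw [← Finset.sum_smul, hu0, zero_smul, sub_zero]
    simp only [← Pi.single_smul, smul_eq_mul, mul_one]
    exact (Finset.univ_sum_single u).symm
  rw [hsum]
  exact A.sum_mem fun i _ => ZMod.smul_mem (hsingle i a) (u i)

theorem exists_mem_sub_mem_constTuples {p n : ℕ} [Fact p.Prime] {w : Fin n → ZMod p}
    (hw : ¬ p ∣ n ∨ w ∈ sumZero p n) {A : AddSubgroup (Fin n → ZMod p)}
    (hA : ∀ σ : Equiv.Perm (Fin n), w - w ∘ σ ∈ A) :
    ∃ u ∈ A, w - u ∈ constTuples p n := by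
  by_cases hconst : w ∈ constTuples p n
  · exact ⟨0, A.zero_mem, by simpa using hconst⟩
  have hab : ∃ a b, w a ≠ w b := by
    by_contra! h
    exact hconst h
  obtain ⟨a, b, hab⟩ := hab
  have hle := sumZero_le_of_forall_sub_comp_mem hA hab
  rcases hw with hpn | hw
  · refine ⟨w - fun _ => (n : ZMod p)⁻¹ * ∑ i, w i, hle ?_, fun i j => by simp⟩
    have hn : (n : ZMod p) ≠ 0 := by rwa [Ne, ZMod.natCast_eq_zero_iff]
    change ∑ i, (w i - (n : ZMod p)⁻¹ * ∑ j, w j) = 0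
    rw [Finset.sum_sub_distrib, Finset.sum_const, Finset.card_univ, Fintype.card_fin,
      nsmul_eq_mul, mul_inv_cancel_left₀ hn, sub_self]
  · exact ⟨w, hle hw, by simp⟩

theorem permAction_ofAdd (n : ℕ) {A : Type*} [AddCommGroup A] (σ : Equiv.Perm (Fin n))
    (u : Fin n → A) :
    permAction n A σ (Multiplicative.ofAdd u) = Multiplicative.ofAdd (u ∘ ⇑σ⁻¹) := rfl

theorem toAdd_left_mem_sumZero {p n : ℕ} {x : Wreath p n} (hx : x ∈ Bsub p n ⊔ Vminus p n) :
    x.left.toAdd ∈ sumZero p n := by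
  let f : Wreath p n →* Multiplicative (ZMod p) :=
    MonoidHom.mk' (fun g => Multiplicative.ofAdd (∑ i, g.left.toAdd i)) fun g h => by
      rw [← ofAdd_add, SemidirectProduct.mul_left, toAdd_mul]
      simp only [Pi.add_apply, Finset.sum_add_distrib]
      congr 2
      exact Equiv.sum_comp g.right⁻¹ (fun i => h.left.toAdd i)
  have hle : Bsub p n ⊔ Vminus p n ≤ f.ker := by
    refine sup_le ?_ ?_
    · rintro _ ⟨b, rfl⟩
      simp [f, MonoidHom.mem_ker]
    · rintro _ ⟨u, hu, rfl⟩
      exact congrArg Multiplicative.ofAdd (show ∑ i, u.toAdd i = 0 from hu)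
  exact Multiplicative.ofAdd.injective (hle hx)

theorem inl_commute_of_mem_constTuples {p n : ℕ} {c : Fin n → ZMod p}
    (hc : c ∈ constTuples p n) (y : Wreath p n) :
    Commute (SemidirectProduct.inl (Multiplicative.ofAdd c)) y := by
  have hfix : permAction n (ZMod p) y.right (Multiplicative.ofAdd c) = Multiplicative.ofAdd c :=
    congrArg Multiplicative.ofAdd (funext fun i => hc _ i)
  refine SemidirectProduct.ext ?_ ?_
  · simp [hfix, mul_comm]
  · simp

/-- The embedding of `V = ∏ V_i` into the product of the wreath products. -/
def inlPi {t : ℕ} (p n : Fin t → ℕ) :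
    Multiplicative (∀ i, Fin (n i) → ZMod (p i)) →* (∀ i, Wreath (p i) (n i)) :=
  MonoidHom.mk' (fun u i => SemidirectProduct.inl (Multiplicative.ofAdd (u.toAdd i)))
    fun _ _ => funext fun _ => map_mul SemidirectProduct.inl _ _

theorem inlPi_conj_mul_inv {t : ℕ} (p n : Fin t → ℕ) (w : ∀ i, Fin (n i) → ZMod (p i))
    (k : ∀ i, Wreath (p i) (n i)) :
    inlPi p n (Multiplicative.ofAdd w) * k * (inlPi p n (Multiplicative.ofAdd w))⁻¹ * k⁻¹ =
      inlPi p n (Multiplicative.ofAdd fun i => w i - w i ∘ ⇑(k i).right⁻¹) := by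
  funext i
  have h : k i * (SemidirectProduct.inl (Multiplicative.ofAdd (w i)))⁻¹ * (k i)⁻¹ =
      SemidirectProduct.inl (Multiplicative.ofAdd (w i ∘ ⇑(k i).right⁻¹))⁻¹ := by
    rw [← permAction_ofAdd]
    refine SemidirectProduct.ext ?_ ?_
    · simp [mul_comm]
    · simp
  change SemidirectProduct.inl (Multiplicative.ofAdd (w i)) * k i *
      (SemidirectProduct.inl (Multiplicative.ofAdd (w i)))⁻¹ * (k i)⁻¹ =
      SemidirectProduct.inl (Multiplicative.ofAdd (w i - w i ∘ ⇑(k i).right⁻¹))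
  rw [mul_assoc, mul_assoc, ← mul_assoc (k i), h, ← map_mul, ofAdd_sub, div_eq_mul_inv]

theorem eq_inlPi_of_projB_eq_one {t : ℕ} {p n : Fin t → ℕ} {v : ∀ i, Wreath (p i) (n i)}
    (hv : projB p n v = 1) :
    v = inlPi p n (Multiplicative.ofAdd fun i => (v i).left.toAdd) :=
  funext fun i => SemidirectProduct.ext rfl (congrFun hv i)

/-- Suppose `L` contains the commutators of `w ∈ V` with representatives of all elements of `B`.
Then `w` is congruent modulo the `B`-invariant elements of `V` to an element of `L`. -/
theorem exists_inlPi_mem_sub_mem_constTuples {t : ℕ} {p n : Fin t → ℕ} (hp : ∀ i, (p i).Prime)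
    {w : ∀ i, Fin (n i) → ZMod (p i)} (hw : ∀ i, ¬ p i ∣ n i ∨ w i ∈ sumZero (p i) (n i))
    {L : Subgroup (∀ i, Wreath (p i) (n i))}
    (hL : ∀ b : ∀ i, Equiv.Perm (Fin (n i)),
      inlPi p n (Multiplicative.ofAdd fun i => w i - w i ∘ b i) ∈ L) :
    ∃ u, inlPi p n (Multiplicative.ofAdd u) ∈ L ∧
      ∀ i, w i - u i ∈ constTuples (p i) (n i) := by
  let A : AddSubgroup (∀ i, Fin (n i) → ZMod (p i)) := (L.comap (inlPi p n)).toAddSubgroup'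
  have hcomp : ∀ i, ∃ u ∈ A.comap (AddMonoidHom.single (fun i => Fin (n i) → ZMod (p i)) i),
      w i - u ∈ constTuples (p i) (n i) := by
    intro i
    have := Fact.mk (hp i)
    refine exists_mem_sub_mem_constTuples (hw i) fun σ => ?_
    have h : (fun j => w j - w j ∘ (Pi.mulSingle i σ : ∀ j, Equiv.Perm (Fin (n j))) j) =
        Pi.single i (w i - w i ∘ σ) := by
      funext j
      rcases eq_or_ne j i with rfl | hj
      · simp
      · simp [Pi.mulSingle_eq_of_ne hj, Pi.single_eq_of_ne hj]
    have := hL (Pi.mulSingle i σ)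
    rw [h] at this
    exact this
  choose u huA huc using hcomp
  refine ⟨u, ?_, huc⟩
  have hu : u ∈ A := by
    rw [← Finset.univ_sum_single u]
    exact A.sum_mem fun i _ => huA i
  exact hu

/-- Let `G = ∏ (ℤ_{p i} ≀ Sym_{n i})` with all `p i` odd primes, and suppose `p i ∤ n i`
for `i < t₀` and `p i ∣ n i` for `i ≥ t₀`. Let
`R = ∏_{i < t₀} B_i V_i × ∏_{i ≥ t₀} B_i V_i⁻`. If `H ≤ K ≤ R` and `H` projects onto
`B = ∏ Sym_{n i}`, then `H` is pronormal in `K`. -/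
theorem pronormal_in_R (t : ℕ) (ht : 0 < t) (p n : Fin t → ℕ)
    (hp : ∀ i, (p i).Prime) (hodd : ∀ i, Odd (p i)) (hn : ∀ i, 0 < n i)
    (t₀ : ℕ) (ht₀ : t₀ ≤ t)
    (hdvd : ∀ i : Fin t, ((i : ℕ) < t₀ → ¬ p i ∣ n i) ∧ (t₀ ≤ (i : ℕ) → p i ∣ n i))
    (H K : Subgroup (∀ i, Wreath (p i) (n i)))
    (hHK : H ≤ K)
    (hKR : K ≤ Subgroup.pi Set.univ fun i : Fin t =>
      if (i : ℕ) < t₀ then Bsub (p i) (n i) ⊔ Vfull (p i) (n i)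
      else Bsub (p i) (n i) ⊔ Vminus (p i) (n i))
    (hH : H.map (projB p n) = ⊤) :
    IsPronormal (H.subgroupOf K) := by
  refine isPronormal_of_forall_exists_commute fun g => ?_
  obtain ⟨h, hh, hhg⟩ : projB p n g ∈ H.map (projB p n) := hH ▸ Subgroup.mem_top _
  set L := H.subgroupOf K ⊔ (H.subgroupOf K).map (MulAut.conj g).toMonoidHom
  have hHL : ∀ k : K, (k : ∀ i, Wreath (p i) (n i)) ∈ H → k ∈ L := fun k hk =>
    Subgroup.mem_sup_left (Subgroup.mem_subgroupOf.2 hk)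
  set h' : K := ⟨h, hHK hh⟩
  set v : K := g * h'⁻¹ with hv
  have hv1 : projB p n v = 1 := by
    simp only [hv, Subgroup.coe_mul, Subgroup.coe_inv, map_mul, map_inv]
    rw [← hhg]
    exact mul_inv_cancel _
  have hconj : ∀ k : K, (k : ∀ i, Wreath (p i) (n i)) ∈ H → v * k * v⁻¹ ∈ L := by
    intro k hk
    refine Subgroup.mem_sup_right ⟨h'⁻¹ * k * h', ?_, ?_⟩
    · exact H.mul_mem (H.mul_mem (H.inv_mem hh) hk) hh
    · simp only [MulEquiv.coe_toMonoidHom, MulAut.conj_apply, hv]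
      group
  have hvw := eq_inlPi_of_projB_eq_one hv1
  set w : ∀ i, Fin (n i) → ZMod (p i) := fun i =>
    ((v : ∀ i, Wreath (p i) (n i)) i).left.toAdd
  have hw : ∀ i, ¬ p i ∣ n i ∨ w i ∈ sumZero (p i) (n i) := by
    intro i
    rcases lt_or_ge (i : ℕ) t₀ with hi | hi
    · exact Or.inl ((hdvd i).1 hi)
    · have hvi : (v : ∀ i, Wreath (p i) (n i)) i ∈
          if (i : ℕ) < t₀ then Bsub (p i) (n i) ⊔ Vfull (p i) (n i)
          else Bsub (p i) (n i) ⊔ Vminus (p i) (n i) := hKR v.2 i (Set.mem_univ i)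
      rw [if_neg hi.not_gt] at hvi
      exact Or.inr (toAdd_left_mem_sumZero hvi)
  obtain ⟨u, ⟨x, hxL, hx⟩, huc⟩ :=
    exists_inlPi_mem_sub_mem_constTuples hp hw (L := L.map K.subtype) fun b => by
      obtain ⟨k, hk, hkb⟩ : b⁻¹ ∈ H.map (projB p n) := hH ▸ Subgroup.mem_top _
      have hb : ∀ i, (k i).right⁻¹ = b i := fun i => by
        rw [show (k i).right = (b i)⁻¹ from congrFun hkb i, inv_inv]
      refine ⟨v * ⟨k, hHK hk⟩ * v⁻¹ * (⟨k, hHK hk⟩ : K)⁻¹,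
        L.mul_mem (hconj _ hk) (L.inv_mem (hHL _ hk)), ?_⟩
      have := inlPi_conj_mul_inv p n w k
      simp only [hb] at this
      rw [← this, ← hvw]
      rfl
  refine ⟨x, hxL, h', hh, fun k _ => Subtype.ext ?_⟩
  have hxv : ((x⁻¹ * v : K) : ∀ i, Wreath (p i) (n i)) =
      inlPi p n (Multiplicative.ofAdd (w - u)) := by
    rw [Subgroup.coe_mul, Subgroup.coe_inv, hvw, show (x : ∀ i, Wreath (p i) (n i)) = _ from hx,
      ← map_inv, ← map_mul, ← ofAdd_neg, ← ofAdd_add, neg_add_eq_sub]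
  change ((x⁻¹ * v : K) : ∀ i, Wreath (p i) (n i)) * k =
    k * ((x⁻¹ * v : K) : ∀ i, Wreath (p i) (n i))
  rw [hxv]
  exact funext fun i => inl_commute_of_mem_constTuples (huc i) _
end

section
/- Let p be an odd prime and n a positive integer, and let G = ℤ_p ≀ Sym_n = V ⋊ B as described. Then the subgroup BV⁻ generated by B and V⁻ is a proper normal subgroup of G of odd index, and it is the only one: every proper normal subgroup of G of odd index equals BV⁻. -/
/-- The homomorphism sending `(v, σ)` in the wreath product to the sum of the coordinates of
`v`. -/
def Wreath.coordSum (p n : ℕ) : Wreath p n →* Multiplicative (ZMod p) where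
  toFun g := Multiplicative.ofAdd (∑ i, Multiplicative.toAdd g.left i)
  map_one' := by simp
  map_mul' g h := by
    rw [← ofAdd_add]
    congr 1
    rw [SemidirectProduct.mul_left, toAdd_mul]
    simp only [Pi.add_apply, Finset.sum_add_distrib]
    congr 1
    exact Equiv.sum_comp g.right.symm (fun i => Multiplicative.toAdd h.left i)

lemma Wreath.mem_ker_coordSum {p n : ℕ} (g : Wreath p n) :
    g ∈ (Wreath.coordSum p n).ker ↔ ∑ i, Multiplicative.toAdd g.left i = 0 := by
  rw [MonoidHom.mem_ker]
  exact ofAdd_eq_one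

lemma Wreath.coordSum_surjective {p n : ℕ} (hn : 0 < n) :
    Function.Surjective (Wreath.coordSum p n) := by
  intro a
  refine ⟨SemidirectProduct.inl
    (Multiplicative.ofAdd (Pi.single ⟨0, hn⟩ (Multiplicative.toAdd a))), ?_⟩
  change Multiplicative.ofAdd (∑ i, (Pi.single ⟨0, hn⟩ (Multiplicative.toAdd a) :
    Fin n → ZMod p) i) = a
  rw [Finset.sum_pi_single', if_pos (Finset.mem_univ _), ofAdd_toAdd]

lemma Wreath.Bsub_sup_Vminus_eq_ker (p n : ℕ) :
    Bsub p n ⊔ Vminus p n = (Wreath.coordSum p n).ker := by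
  apply le_antisymm
  · rw [sup_le_iff]
    constructor
    · rintro _ ⟨σ, rfl⟩
      rw [Wreath.mem_ker_coordSum]
      simp
    · rintro _ ⟨v, hv, rfl⟩
      rw [Wreath.mem_ker_coordSum, SemidirectProduct.left_inl]
      exact hv
  · intro g hg
    rw [Wreath.mem_ker_coordSum] at hg
    rw [← SemidirectProduct.inl_left_mul_inr_right g]
    exact mul_mem (Subgroup.mem_sup_right ⟨g.left, hg, rfl⟩)
      (Subgroup.mem_sup_left ⟨g.right, rfl⟩)

lemma Wreath.index_ker_coordSum {p n : ℕ} (hn : 0 < n) :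
    (Wreath.coordSum p n).ker.index = p := by
  rw [Subgroup.index_ker, MonoidHom.range_eq_top.mpr (Wreath.coordSum_surjective hn),
    Subgroup.card_top]
  exact Nat.card_zmod p

/-- A normal subgroup of odd index contains every element whose square is trivial. -/
lemma Subgroup.mem_of_sq_eq_one_of_odd_index {G : Type*} [Group G] (K : Subgroup G) [K.Normal]
    (hK : Odd K.index) {g : G} (hg : g ^ 2 = 1) : g ∈ K := by
  obtain ⟨k, hk⟩ := hK
  have h := K.pow_index_mem g
  rwa [hk, pow_succ, pow_mul, hg, one_pow, one_mul] at h

lemma Wreath.Bsub_le_of_odd_index {p n : ℕ} (K : Subgroup (Wreath p n)) [K.Normal]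
    (hK : Odd K.index) : Bsub p n ≤ K := by
  rw [Bsub, MonoidHom.range_eq_map, Subgroup.map_le_iff_le_comap,
    ← Equiv.Perm.closure_isSwap, Subgroup.closure_le]
  rintro _ ⟨i, j, -, rfl⟩
  refine K.mem_of_sq_eq_one_of_odd_index hK ?_
  rw [← map_pow, sq, Equiv.swap_mul_self, map_one]

lemma Wreath.Vminus_le_of_Bsub_le {p n : ℕ} (hn : 0 < n) (K : Subgroup (Wreath p n)) [K.Normal]
    (hB : Bsub p n ≤ K) : Vminus p n ≤ K := by
  have hcomm (i j : Fin n) (a : ZMod p) :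
      Multiplicative.ofAdd (Pi.single i a - Pi.single j a) ∈
        K.comap (SemidirectProduct.inl : _ →* Wreath p n) := by
    have hs : (SemidirectProduct.inr (Equiv.swap i j) : Wreath p n) ∈ K := hB ⟨_, rfl⟩
    have h := K.mul_mem (Subgroup.Normal.conj_mem ‹_› _ hs
      (SemidirectProduct.inl (Multiplicative.ofAdd (Pi.single i a)))) (K.inv_mem hs)
    rw [Subgroup.mem_comap]
    convert h using 1
    rw [← map_inv SemidirectProduct.inl, mul_assoc, mul_assoc,
      ← mul_assoc (SemidirectProduct.inr _), ← map_inv SemidirectProduct.inr,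
      ← SemidirectProduct.inl_aut, ← map_mul]
    congr 1
    rw [sub_eq_add_neg, ofAdd_add, map_inv, ofAdd_neg]
    congr 2
    funext k
    change (Pi.single j a : Fin n → ZMod p) k =
      (Pi.single i a : Fin n → ZMod p) ((Equiv.swap i j).symm k)
    simp only [Pi.single_apply, Equiv.symm_apply_eq, Equiv.swap_apply_left]
  rintro _ ⟨v, hv, rfl⟩
  have hsum : ∑ i, Multiplicative.toAdd v i = 0 := hv
  have hv' : v = ∏ i, Multiplicative.ofAdd
      (Pi.single i (Multiplicative.toAdd v i) -
        Pi.single ⟨0, hn⟩ (Multiplicative.toAdd v i)) := by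
    apply Multiplicative.toAdd.injective
    rw [toAdd_prod]
    simp only [toAdd_ofAdd, Finset.sum_sub_distrib]
    have hsingle := map_sum (AddMonoidHom.single (fun _ : Fin n => ZMod p) ⟨0, hn⟩)
      (Multiplicative.toAdd v) Finset.univ
    simp only [AddMonoidHom.single_apply] at hsingle
    rw [Finset.univ_sum_single, ← hsingle, hsum, Pi.single_zero, sub_zero]
  have h : v ∈ K.comap (SemidirectProduct.inl : _ →* Wreath p n) := by
    rw [hv']
    exact Subgroup.prod_mem _ fun i _ => hcomm i _ _
  exact h

/-- For an odd prime `p`, the subgroup `BV⁻` is the unique proper normal subgroup of odd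
index in `ℤ_p ≀ Sym_n`. -/
theorem unique_proper_normal_odd_index (p n : ℕ) (hp : p.Prime) (hodd : Odd p) (hn : 0 < n) :
    (Bsub p n ⊔ Vminus p n ≠ ⊤ ∧ (Bsub p n ⊔ Vminus p n).Normal ∧
      Odd (Bsub p n ⊔ Vminus p n).index) ∧
    ∀ K : Subgroup (Wreath p n), K.Normal → K ≠ ⊤ → Odd K.index →
      K = Bsub p n ⊔ Vminus p n := by
  have hindex := Wreath.index_ker_coordSum (p := p) hn
  rw [Wreath.Bsub_sup_Vminus_eq_ker]
  refine ⟨⟨?_, inferInstance, hindex.symm ▸ hodd⟩, fun K hKn hKtop hKodd => ?_⟩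
  · intro h
    rw [h, Subgroup.index_top] at hindex
    exact hp.one_lt.ne hindex
  · have hB := Wreath.Bsub_le_of_odd_index K hKodd
    have hle : (Wreath.coordSum p n).ker ≤ K := by
      rw [← Wreath.Bsub_sup_Vminus_eq_ker]
      exact sup_le hB (Wreath.Vminus_le_of_Bsub_le hn K hB)
    have hmul := Subgroup.relIndex_mul_index hle
    rw [hindex] at hmul
    have hK : K.index = p :=
      ((Nat.dvd_prime hp).mp (Dvd.intro_left _ hmul)).resolve_left
        (mt Subgroup.index_eq_one.mp hKtop)
    rw [hK] at hmul
    exact le_antisymm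
      (Subgroup.relIndex_eq_one.mp
        (Nat.eq_of_mul_eq_mul_right hp.pos (hmul.trans (one_mul p).symm)))
      hle
end

section
/- Let p be an odd prime and n a positive integer, and let G = ℤ_p ≀ Sym_n = V ⋊ B as described. Then the subgroup BV⁻ of G generated by B and V⁻ contains no proper normal subgroup of odd index: every normal subgroup of BV⁻ of odd index in BV⁻ equals BV⁻. -/
/-- A normal subgroup of odd index contains every involution. -/
theorem Subgroup.mem_of_odd_index_of_mul_self_eq_one {G : Type*} [Group G] (N : Subgroup G)
    [N.Normal] (hN : Odd N.index) {g : G} (hg : g * g = 1) : g ∈ N := by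
  obtain ⟨k, hk⟩ := hN
  have h := N.pow_index_mem g
  rwa [hk, pow_succ, pow_mul, pow_two, hg, one_pow, one_mul] at h

/-- Relative form of `Subgroup.mem_of_odd_index_of_mul_self_eq_one`. -/
theorem Subgroup.mem_of_odd_index_subgroupOf {G : Type*} [Group G] {K H : Subgroup G}
    (hnorm : (K.subgroupOf H).Normal) (hodd : Odd (K.subgroupOf H).index)
    {g : G} (hgH : g ∈ H) (hg : g * g = 1) : g ∈ K :=
  Subgroup.mem_subgroupOf.mp
    (Subgroup.mem_of_odd_index_of_mul_self_eq_one (K.subgroupOf H) hodd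
      (g := ⟨g, hgH⟩) (Subtype.ext hg))

theorem single_sub_single_mem_sumZero (p n : ℕ) (i j : Fin n) (a : ZMod p) :
    (Pi.single i a - Pi.single j a : Fin n → ZMod p) ∈ sumZero p n := by
  change ∑ k, (Pi.single i a - Pi.single j a : Fin n → ZMod p) k = 0
  simp [Finset.sum_sub_distrib]

theorem permAction_swap_single_sub_single (p n : ℕ) (i j : Fin n) (a : ZMod p) :
    permAction n (ZMod p) (Equiv.swap i j)
        (Multiplicative.ofAdd (Pi.single i a - Pi.single j a)) =
      (Multiplicative.ofAdd (Pi.single i a - Pi.single j a : Fin n → ZMod p))⁻¹ := by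
  apply Multiplicative.toAdd.injective
  funext k
  change (Pi.single i a - Pi.single j a : Fin n → ZMod p) ((Equiv.swap i j).symm k) =
    -(Pi.single i a - Pi.single j a : Fin n → ZMod p) k
  simp only [Equiv.symm_swap, Equiv.swap_apply_def, Pi.sub_apply, Pi.single_apply]
  split_ifs <;> simp_all

/-- Tuples with coordinate sum `0` are sums of differences of coordinate vectors. -/
theorem eq_sum_single_sub_single {p n : ℕ} (i₀ : Fin n) {v : Fin n → ZMod p}
    (hv : v ∈ sumZero p n) : v = ∑ i, (Pi.single i (v i) - Pi.single i₀ (v i)) := by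
  have hv' : ∑ i, v i = 0 := hv
  rw [Finset.sum_sub_distrib, Finset.univ_sum_single]
  have h : ∑ i, (Pi.single i₀ (v i) : Fin n → ZMod p) = Pi.single i₀ (∑ i, v i) :=
    (map_sum (AddMonoidHom.single (fun _ : Fin n => ZMod p) i₀) v Finset.univ).symm
  rw [h, hv', Pi.single_zero, sub_zero]

/-- For an odd prime `p`, the subgroup `BV⁻` of `ℤ_p ≀ Sym_n` has no proper normal
subgroup of odd index. -/
theorem no_proper_normal_odd_index (p n : ℕ) (hp : p.Prime) (hodd : Odd p) (hn : 0 < n)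
    (K : Subgroup (Wreath p n)) (hK : K ≤ Bsub p n ⊔ Vminus p n)
    (hnorm : (K.subgroupOf (Bsub p n ⊔ Vminus p n)).Normal)
    (hoddi : Odd (K.subgroupOf (Bsub p n ⊔ Vminus p n)).index) :
    K = Bsub p n ⊔ Vminus p n := by
  have hBH : ∀ σ : Equiv.Perm (Fin n),
      (SemidirectProduct.inr σ : Wreath p n) ∈ Bsub p n ⊔ Vminus p n := fun σ =>
    Subgroup.mem_sup_left ⟨σ, rfl⟩
  have hVH : ∀ v ∈ sumZero p n,
      (SemidirectProduct.inl (Multiplicative.ofAdd v) : Wreath p n) ∈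
        Bsub p n ⊔ Vminus p n := fun v hv =>
    Subgroup.mem_sup_right ⟨Multiplicative.ofAdd v, hv, rfl⟩
  have hswap : ∀ i j : Fin n, (SemidirectProduct.inr (Equiv.swap i j) : Wreath p n) ∈ K := by
    intro i j
    refine Subgroup.mem_of_odd_index_subgroupOf hnorm hoddi (hBH _) ?_
    rw [← map_mul, Equiv.swap_mul_self, map_one]
  have hB : Bsub p n ≤ K := by
    rintro _ ⟨σ, rfl⟩
    refine Equiv.Perm.swap_induction_on σ ?_ ?_
    · rw [map_one]
      exact K.one_mem
    · intro τ i j _ hτ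
      rw [map_mul]
      exact K.mul_mem (hswap i j) hτ
  have hdiff : ∀ (i j : Fin n) (a : ZMod p),
      (SemidirectProduct.inl (Multiplicative.ofAdd (Pi.single i a - Pi.single j a)) :
        Wreath p n) ∈ K := by
    intro i j a
    obtain ⟨k, hk⟩ := hodd
    have htwo : ((k + 1 : ℕ) : ZMod p) * a + ((k + 1 : ℕ) : ZMod p) * a = a := by
      have h : ((2 * k + 1 : ℕ) : ZMod p) = 0 := by rw [← hk, ZMod.natCast_self]
      push_cast at h ⊢
      linear_combination a * h
    set b : ZMod p := ((k + 1 : ℕ) : ZMod p) * a with hb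
    set w : Multiplicative (Fin n → ZMod p) :=
      Multiplicative.ofAdd (Pi.single i b - Pi.single j b) with hw
    have hww : Multiplicative.ofAdd (Pi.single i a - Pi.single j a) = w * w := by
      rw [hw, ← ofAdd_add, sub_add_sub_comm, ← Pi.single_add, ← Pi.single_add, htwo]
    have hact : (SemidirectProduct.inr (Equiv.swap i j) : Wreath p n) *
        SemidirectProduct.inl w * SemidirectProduct.inr (Equiv.swap i j) =
          (SemidirectProduct.inl w)⁻¹ := by
      have h := SemidirectProduct.inl_aut (φ := permAction n (ZMod p)) (Equiv.swap i j) w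
      rw [hw, permAction_swap_single_sub_single, Equiv.swap_inv, ← hw, map_inv] at h
      exact h.symm
    have hss : (SemidirectProduct.inr (Equiv.swap i j) : Wreath p n) *
        SemidirectProduct.inr (Equiv.swap i j) = 1 := by
      rw [← map_mul, Equiv.swap_mul_self, map_one]
    have hinv : SemidirectProduct.inl (w * w) * SemidirectProduct.inr (Equiv.swap i j) ∈ K := by
      refine Subgroup.mem_of_odd_index_subgroupOf hnorm hoddi
        (Subgroup.mul_mem _ ?_ (hBH _)) ?_
      · rw [← hww]
        exact hVH _ (single_sub_single_mem_sumZero p n i j a)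
      · generalize (SemidirectProduct.inr (Equiv.swap i j) : Wreath p n) = s at hact hss
        rw [map_mul]
        generalize (SemidirectProduct.inl w : Wreath p n) = x at hact
        have hsx : s * x = x⁻¹ * s := by
          rw [← hact, mul_assoc _ s s, hss, mul_one]
        calc x * x * s * (x * x * s) = x * x * (s * x) * x * s := by group
          _ = x * s * x * s := by rw [hsx]; group
          _ = x * (s * x * s) := by group
          _ = 1 := by rw [hact, mul_inv_cancel]
    rw [hww]
    exact (Subgroup.mul_mem_cancel_right K (hswap i j)).mp hinv
  refine le_antisymm hK (sup_le hB ?_)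
  rintro _ ⟨v, hv, rfl⟩
  let N : AddSubgroup (Fin n → ZMod p) :=
    Subgroup.toAddSubgroup' (K.comap SemidirectProduct.inl)
  have hvN : Multiplicative.toAdd v ∈ N := by
    rw [eq_sum_single_sub_single ⟨0, hn⟩ (v := Multiplicative.toAdd v) hv]
    exact N.sum_mem fun i _ => hdiff i ⟨0, hn⟩ _
  exact hvN
end
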